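/- arXiv:1903.11885 — 5 statements merged into one kernel-verified Lean document; each statement's English description precedes it below -/
import Mathlib

section
/- Let K_f > 0 and K > 0 be real numbers, and let φ, α be real numbers with 0 < φ and 3φ/(2+φ) ≤ α ≤ 1. Then there exists a real number c0 > 0 satisfying the quadratic equation K·c0² − (α + α·φ + (φ·K)/K_f − φ)·c0 + (α²·φ)/K_f = 0. -/
theorem stmt_0 (K Kf φ α : ℝ) (hK : 0 < K) (hKf : 0 < Kf) (hφ : 0 < φ)
    (hα₁ : 3 * φ / (2 + φ) ≤ α) (hα₂ : α ≤ 1) :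
    ∃ c0 : ℝ, 0 < c0 ∧
      K * c0 ^ 2 - (α + α * φ + φ * K / Kf - φ) * c0 + α ^ 2 * φ / Kf = 0 := by
  have h2 : 0 < 2 + φ := by linarith
  rw [div_le_iff₀ h2] at hα₁
  have hφ1 : φ ≤ 1 := by nlinarith
  have hαφ : φ ≤ α := by
    by_contra! h
    nlinarith [mul_pos (sub_pos.mpr h) h2, mul_nonneg hφ.le (sub_nonneg.mpr hφ1)]
  have hs : 0 < φ * K / Kf := by positivity
  have hB : α ^ 2 + φ * K / Kf ≤ α + α * φ + φ * K / Kf - φ := by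
    nlinarith [mul_nonneg (sub_nonneg.mpr hα₂) (sub_nonneg.mpr hαφ)]
  have hC : K * (α ^ 2 * φ / Kf) = α ^ 2 * (φ * K / Kf) := by ring
  generalize α + α * φ + φ * K / Kf - φ = B at hB ⊢
  generalize α ^ 2 * φ / Kf = C at hC ⊢
  generalize φ * K / Kf = s at hs hB hC
  have hB0 : 0 < B := by nlinarith [sq_nonneg α]
  have hD : 0 ≤ B ^ 2 - 4 * (K * C) := by
    rw [hC]
    nlinarith [pow_le_pow_left₀ (by positivity) hB 2, sq_nonneg (α ^ 2 - s)]
  refine ⟨(B + √(B ^ 2 - 4 * (K * C))) / (2 * K), by positivity, ?_⟩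
  have hr := Real.sq_sqrt hD
  generalize √(B ^ 2 - 4 * (K * C)) = r at hr ⊢
  field_simp
  linear_combination hr
end

section
/- Let K be a real number, K_f a nonzero real number, and let φ, α be real numbers with 0 ≤ φ ≤ α ≤ 1. Then the discriminant of the quadratic determining the storage coefficient is nonnegative: (α + α·φ + (φ·K)/K_f − φ)² − 4·α²·φ·K/K_f ≥ 0. -/
theorem stmt_2 (K Kf φ α : ℝ) (hKf : Kf ≠ 0) (hφ : 0 ≤ φ) (hφα : φ ≤ α)
    (hα : α ≤ 1) :
    0 ≤ (α + α * φ + φ * K / Kf - φ) ^ 2 - 4 * α ^ 2 * φ * K / Kf := by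
  have h : (α + α * φ + φ * K / Kf - φ) ^ 2 - 4 * α ^ 2 * φ * K / Kf =
      (φ * K / Kf + (α + α * φ - φ) - 2 * α ^ 2) ^ 2
        + 4 * α ^ 2 * ((1 - α) * (α - φ)) := by
    ring
  have hprod : 0 ≤ (1 - α) * (α - φ) :=
    mul_nonneg (sub_nonneg.2 hα) (sub_nonneg.2 hφα)
  rw [h]
  positivity
end

section
/- Let K > 0 and K_f > 0 be real numbers, and let φ, α be real numbers with 0 ≤ φ ≤ α ≤ 1. Then there exists a real number c0 with c0 ≥ φ/K_f satisfying K·c0² − (α + α·φ + (φ·K)/K_f − φ)·c0 + (α²·φ)/K_f = 0. In particular, the larger root of this quadratic does not violate the physical constraint c0 ≥ φ/K_f. -/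
/-- A quadratic with positive leading coefficient that is nonpositive at `x` has a root at or
to the right of `x`. -/
theorem exists_quadratic_root_ge {a b c x : ℝ} (ha : 0 < a) (hx : a * x ^ 2 - b * x + c ≤ 0) :
    ∃ y : ℝ, x ≤ y ∧ a * y ^ 2 - b * y + c = 0 := by
  have hD : (2 * a * x - b) ^ 2 ≤ b ^ 2 - 4 * a * c := by
    nlinarith [mul_nonneg ha.le (neg_nonneg.mpr hx)]
  have hs := Real.sq_sqrt ((sq_nonneg _).trans hD)
  have hle := Real.le_sqrt_of_sq_le hD
  refine ⟨(b + √(b ^ 2 - 4 * a * c)) / (2 * a), ?_, ?_⟩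
  · rw [le_div_iff₀ (by positivity)]
    linarith
  · generalize √(b ^ 2 - 4 * a * c) = s at hs
    field_simp
    linear_combination hs

theorem stmt_3 (K Kf φ α : ℝ) (hK : 0 < K) (hKf : 0 < Kf) (hφ : 0 ≤ φ)
    (hφα : φ ≤ α) (hα : α ≤ 1) :
    ∃ c0 : ℝ, φ / Kf ≤ c0 ∧
      K * c0 ^ 2 - (α + α * φ + φ * K / Kf - φ) * c0 + α ^ 2 * φ / Kf = 0 := by
  apply exists_quadratic_root_ge hK
  have h : 0 ≤ φ / Kf * ((1 - α) * (α - φ)) :=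
    mul_nonneg (by positivity) (mul_nonneg (by linarith) (by linarith))
  linear_combination h
end

section
/- Let φ be a real number with 0 < φ ≤ 3/4, set α = 2φ/(1+φ), and let K > 0 and K_f > 0 be real numbers. Then there exists a real number c0 with 0 < c0 < φ/K_f satisfying K·c0² − (α + α·φ + (φ·K)/K_f − φ)·c0 + (α²·φ)/K_f = 0; that is, the smaller root of the quadratic violates the physical constraint c0 ≥ φ/K_f. -/
theorem stmt_4 (φ : ℝ) (hφ : 0 < φ) (hφ' : φ ≤ 3 / 4) (α : ℝ)
    (hα : α = 2 * φ / (1 + φ)) (K Kf : ℝ) (hK : 0 < K) (hKf : 0 < Kf) :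
    ∃ c0 : ℝ, 0 < c0 ∧ c0 < φ / Kf ∧
      K * c0 ^ 2 - (α + α * φ + φ * K / Kf - φ) * c0 + α ^ 2 * φ / Kf = 0 := by
  have hα_pos : 0 < α := by rw [hα]; positivity
  have hα_mul : α + α * φ = 2 * φ := by rw [hα]; field_simp
  have hα_sq : α ^ 2 < φ := by
    rw [hα, div_pow, div_lt_iff₀ (by positivity)]
    have h : 0 < φ * (1 - φ) ^ 2 := mul_pos hφ (pow_pos (by linarith) 2)
    nlinarith
  have hx : 0 < φ / Kf := by positivity
  let f : ℝ → ℝ := fun c ↦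
    K * c ^ 2 - (α + α * φ + φ * K / Kf - φ) * c + α ^ 2 * φ / Kf
  have hf : ContinuousOn f (Set.Icc 0 (φ / Kf)) := by fun_prop
  have hf_left : 0 < f 0 := by
    have h : 0 < α ^ 2 * φ / Kf := by positivity
    simpa [f] using h
  have hf_right : f (φ / Kf) < 0 := by
    have h : f (φ / Kf) = φ / Kf * (α ^ 2 - φ) := by
      simp only [f, hα_mul]
      ring
    rw [h]
    exact mul_neg_of_pos_of_neg hx (sub_neg.mpr hα_sq)
  obtain ⟨c, hc, hfc⟩ := intermediate_value_Ioo' hx.le hf ⟨hf_right, hf_left⟩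
  exact ⟨c, hc.1, hc.2, hfc⟩
end

section
/- Let K > 0 and K_f > 0 be real numbers, and let φ, α be real numbers with 0 < φ ≤ α. Then every real solution c0 of the quadratic equation K·c0² − (α + α·φ + (φ·K)/K_f − φ)·c0 + (α²·φ)/K_f = 0 satisfies c0 > 0. -/
theorem stmt_8 (K Kf φ α : ℝ) (hK : 0 < K) (hKf : 0 < Kf) (hφ : 0 < φ)
    (hφα : φ ≤ α) :
    ∀ c0 : ℝ,
      K * c0 ^ 2 - (α + α * φ + φ * K / Kf - φ) * c0 + α ^ 2 * φ / Kf = 0 →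
        0 < c0 := by
  intro c0 h
  by_contra! hc
  have hα : 0 < α := hφ.trans_le hφα
  have hquad : 0 ≤ K * c0 ^ 2 := by positivity
  have hconst : 0 < α ^ 2 * φ / Kf := by positivity
  have hcoeff : 0 ≤ α + α * φ + φ * K / Kf - φ := by
    have : 0 < α * φ + φ * K / Kf := by positivity
    linarith
  have hlin := mul_nonpos_of_nonneg_of_nonpos hcoeff hc
  linarith
end
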